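/- Define φ : Bool × Bool × Bool → ℝ by φ(a,b,c) = 0 if a = b and b = c, and φ(a,b,c) = 1 otherwise, and define ω(a,b,c) = φ(a,b,c)/6. Then ω is a probability distribution on Bool × Bool × Bool, but there do not exist nonnegative functions g_A, g_B : Bool → ℝ with ∑_a g_A(a) = 1 and ∑_b g_B(b) = 1, and g_C : Bool → Bool → Bool → ℝ nonnegative with ∑_c g_C a b c = 1 for all a, b, such that ω(a,b,c) = g_A(a) · g_B(b) · g_C a b c for all a, b, c. -/

import Mathlib

/-- **The chordality restriction in Functorial Variable Elimination cannot be dropped**: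
the distribution `ω` on `Bool × Bool × Bool` proportional to the v-structure-shaped factor
`φ` admits no factorisation into stochastic conditionals over the DAG `A → C ← B`. -/
theorem stmt15 :
    let φ : Bool × Bool × Bool → ℝ :=
      fun p => if p.1 = p.2.1 ∧ p.2.1 = p.2.2 then 0 else 1
    let ω : Bool × Bool × Bool → ℝ := fun p => φ p / 6
    (∀ p, 0 ≤ ω p) ∧ (∑ p, ω p = 1) ∧
      ¬ ∃ (gA gB : Bool → ℝ) (gC : Bool → Bool → Bool → ℝ),
          (∀ a, 0 ≤ gA a) ∧ (∀ b, 0 ≤ gB b) ∧ (∀ a b c, 0 ≤ gC a b c) ∧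
          (∑ a, gA a = 1) ∧ (∑ b, gB b = 1) ∧ (∀ a b, ∑ c, gC a b c = 1) ∧
          (∀ a b c, ω (a, b, c) = gA a * gB b * gC a b c) := by
  intro φ ω
  refine ⟨?_, ?_, ?_⟩
  · intro p
    simp only [ω, φ]
    split_ifs <;> norm_num
  · simp [ω, φ, Fintype.sum_prod_type]
    norm_num
  · rintro ⟨gA, gB, gC, -, -, -, -, -, hC, h⟩
    -- the marginal of `ω` on `(a, b)` would be the product `gA a * gB b`
    have key : ∀ a b, gA a * gB b = ω (a, b, true) + ω (a, b, false) := by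
      intro a b
      have h1 := hC a b
      rw [Fintype.sum_bool] at h1
      rw [h, h, ← mul_add, h1, mul_one]
    have h1 : gA true * gB true = 1 / 6 := by rw [key]; simp [ω, φ]
    have h2 : gA false * gB false = 1 / 6 := by rw [key]; simp [ω, φ]
    have h3 : gA true * gB false = 1 / 3 := by rw [key]; simp [ω, φ]; norm_num
    have h4 : gA false * gB true = 1 / 3 := by rw [key]; simp [ω, φ]; norm_num
    have h5 : (gA true * gB true) * (gA false * gB false)
        = (gA true * gB false) * (gA false * gB true) := by ring
    rw [h1, h2, h3, h4] at h5
    norm_num at h5
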